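/- Let t ∈ ℂ and let x₁, x₂, x₃, x₄ ∈ SL(2,ℂ) with tr(xᵢ) = t for all i, such that r₁ = r₂ = r₃ = r₄ where rᵢ = xᵢxᵢ₊₁xᵢ⁻¹xᵢ₋₁xᵢ (subscripts modulo 4), each of the triples (x₁,x₂,x₃), (x₁,x₂,x₄), (x₁,x₃,x₄), (x₂,x₃,x₄) is irreducible, tr(xᵢxᵢ₊₁) ≠ 1 for all i (subscripts modulo 4), tr(x₁x₃) = tr(x₂x₄), tr(x₁x₄) = tr(x₂x₃), and tr(x₁x₂) ≠ tr(x₃x₄). Set s₁₂₃ = tr(x̌₁x̌₂x̌₃) and s₂₃₄ = tr(x̌₂x̌₃x̌₄). Then either (t = 0 and s₁₂₃ = 0 and s₂₃₄ = 0) or t·s₁₂₃·s₂₃₄ ≠ 0. -/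

import Mathlib

open Matrix

local notation "𝕄" => Matrix (Fin 2) (Fin 2) ℂ
local notation "SL2" => Matrix.SpecialLinearGroup (Fin 2) ℂ

/-- A family of 2×2 complex matrices is irreducible if there is no nonzero vector
`v ∈ ℂ²` which is a common eigenvector of all members. -/
def IsIrreducibleFamily {ι : Type*} (x : ι → Matrix (Fin 2) (Fin 2) ℂ) : Prop :=
  ¬ ∃ v : Fin 2 → ℂ, v ≠ 0 ∧ ∀ i, ∃ a : ℂ, (x i).mulVec v = a • v

/-- `x̌ = x − (tr x / 2)·I`, the trace-free part of a 2×2 matrix. -/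
noncomputable def chk (x : Matrix (Fin 2) (Fin 2) ℂ) : Matrix (Fin 2) (Fin 2) ℂ :=
  x - (x.trace / 2) • 1

/-- half the trace of the product of two trace-free matrices given by their entries -/
noncomputable def sp15 (p q r p' q' r' : ℂ) : ℂ := p * p' + (q * r' + r * q') / 2

/-- triple product (half of the trace of the product of three trace-free matrices) -/
noncomputable def tp15 (p q r p' q' r' p'' q'' r'' : ℂ) : ℂ :=
  (p * (q' * r'' - r' * q'') + q * (r' * p'' - p' * r'') + r * (p' * q'' - q' * p'')) / 2

/-- vector expansion of `x y x⁻¹ w x`. -/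
lemma expand15 (u p q r p' q' r' p'' q'' r'' : ℂ)
    (h : u ^ 2 - p ^ 2 - q * r = 1) :
    ∃ S A : ℂ,
      !![u + p, q; r, u - p] * !![u + p', q'; r', u - p'] * !![u - p, -q; -r, u + p]
        * !![u + p'', q''; r'', u - p''] * !![u + p, q; r, u - p]
      = S • (1 : Matrix (Fin 2) (Fin 2) ℂ) + A • !![p, q; r, -p]
        + (u ^ 2 - sp15 p q r p'' q'' r'') • !![p', q'; r', -p']
        + (u ^ 2 - sp15 p q r p' q' r') • !![p'', q''; r'', -p'']
        + (u / 2) • (!![p, q; r, -p] * !![p', q'; r', -p'] - !![p', q'; r', -p'] * !![p, q; r, -p]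
          + (!![p', q'; r', -p'] * !![p'', q''; r'', -p'']
            - !![p'', q''; r'', -p''] * !![p', q'; r', -p'])
          + (!![p'', q''; r'', -p''] * !![p, q; r, -p]
            - !![p, q; r, -p] * !![p'', q''; r'', -p''])) := by
  refine ⟨2 * u * (2 * u ^ 3 + 2 * u * (sp15 p q r p' q' r' + sp15 p q r p'' q'' r''
        + sp15 p' q' r' p'' q'' r'') + 2 * tp15 p q r p' q' r' p'' q'' r'') * u
      - 2 * u * (u ^ 2 + sp15 p' q' r' p'' q'' r'')
      - 4 * (u ^ 2 + sp15 p q r p' q' r') * (u ^ 2 + sp15 p q r p'' q'' r'') * u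
      + 2 * (u ^ 2 + sp15 p q r p' q' r') * u + u ^ 3
      + u * (sp15 p q r p'' q'' r'' - sp15 p' q' r' p'' q'' r'' - sp15 p q r p' q' r')
      - tp15 p q r p' q' r' p'' q'' r'',
    4 * u ^ 2 * sp15 p' q' r' p'' q'' r'' + 4 * u * tp15 p q r p' q' r' p'' q'' r''
      - 4 * sp15 p q r p' q' r' * sp15 p q r p'' q'' r'' + u ^ 2 - sp15 p' q' r' p'' q'' r'', ?_⟩
  ext i j
  fin_cases i <;> fin_cases j <;> simp [Matrix.mul_apply] <;> simp only [sp15, tp15]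
  · linear_combination (-(2 * u) * ((u - p'') * (u - p') + (-q'') * (-r'))
      + (2 * u ^ 2 + 2 * p * p' + q * r' + r * q') * (u - p'')
      + (((u - p') * (u + p'') + (-q') * r'') * (u + p) + ((u - p') * q'' + (-q') * (u - p'')) * r)) * h
  · linear_combination (-(2 * u) * ((u - p'') * (-q') + (-q'') * (u + p'))
      + (2 * u ^ 2 + 2 * p * p' + q * r' + r * q') * (-q'')
      + (((u - p') * (u + p'') + (-q') * r'') * q + ((u - p') * q'' + (-q') * (u - p'')) * (u - p))) * h
  · linear_combination (-(2 * u) * ((-r'') * (u - p') + (u + p'') * (-r'))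
      + (2 * u ^ 2 + 2 * p * p' + q * r' + r * q') * (-r'')
      + (((-r') * (u + p'') + (u + p') * r'') * (u + p) + ((-r') * q'' + (u + p') * (u - p'')) * r)) * h
  · linear_combination (-(2 * u) * ((-r'') * (-q') + (u + p'') * (u + p'))
      + (2 * u ^ 2 + 2 * p * p' + q * r' + r * q') * (u + p'')
      + (((-r') * (u + p'') + (u + p') * r'') * q + ((-r') * q'' + (u + p') * (u - p'')) * (u - p))) * h

lemma keyE15 (u p1 q1 r1 p2 q2 r2 p3 q3 r3 p4 q4 r4 : ℂ)
    (h2 : u ^ 2 - p2 ^ 2 - q2 * r2 = 1) (h3 : u ^ 2 - p3 ^ 2 - q3 * r3 = 1)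
    (hR : !![u + p2, q2; r2, u - p2] * !![u + p3, q3; r3, u - p3] * !![u - p2, -q2; -r2, u + p2]
        * !![u + p1, q1; r1, u - p1] * !![u + p2, q2; r2, u - p2]
       = !![u + p3, q3; r3, u - p3] * !![u + p4, q4; r4, u - p4] * !![u - p3, -q3; -r3, u + p3]
        * !![u + p2, q2; r2, u - p2] * !![u + p3, q3; r3, u - p3])
    (s3 : tp15 p1 q1 r1 p2 q2 r2 p3 q3 r3 = 0) (s4 : tp15 p1 q1 r1 p2 q2 r2 p4 q4 r4 = 0) :
    u * ((sp15 p1 q1 r1 p2 q2 r2 - sp15 p2 q2 r2 p4 q4 r4)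
        * (sp15 p1 q1 r1 p2 q2 r2 - sp15 p1 q1 r1 p3 q3 r3)
      - (sp15 p1 q1 r1 p1 q1 r1 - sp15 p1 q1 r1 p4 q4 r4)
        * (sp15 p2 q2 r2 p2 q2 r2 - sp15 p2 q2 r2 p3 q3 r3)) = 0 := by
  obtain ⟨S, A, e⟩ := expand15 u p2 q2 r2 p3 q3 r3 p1 q1 r1 h2
  obtain ⟨S', A', e'⟩ := expand15 u p3 q3 r3 p4 q4 r4 p2 q2 r2 h3
  rw [e, e'] at hR
  generalize u ^ 2 - sp15 p2 q2 r2 p1 q1 r1 = k1 at hR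
  generalize u ^ 2 - sp15 p2 q2 r2 p3 q3 r3 = k2 at hR
  generalize u ^ 2 - sp15 p3 q3 r3 p2 q2 r2 = k3 at hR
  generalize u ^ 2 - sp15 p3 q3 r3 p4 q4 r4 = k4 at hR
  have e00 := congrFun (congrFun hR 0) 0
  have e01 := congrFun (congrFun hR 0) 1
  have e10 := congrFun (congrFun hR 1) 0
  have e11 := congrFun (congrFun hR 1) 1
  simp [Matrix.mul_apply] at e00 e01 e10 e11
  simp only [tp15] at s3 s4
  simp only [sp15]
  -- pairing with the cross product n of the first two vectors
  linear_combination (1/4 * (q1 * r2 - r1 * q2)) * (e00 - e11)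
    + (1/2 * (r1 * p2 - p1 * r2)) * e01 + (1/2 * (p1 * q2 - q1 * p2)) * e10 
    - (k1 - A') * s3 + k3 * s4

/-- common eigenvector criterion -/
lemma eig15 (x : Matrix (Fin 2) (Fin 2) ℂ) (v : Fin 2 → ℂ) (hv : v ≠ 0)
    (h : (x 0 0 - x 1 1) * v 0 * v 1 + x 0 1 * v 1 ^ 2 - x 1 0 * v 0 ^ 2 = 0) :
    ∃ a : ℂ, x.mulVec v = a • v := by
  by_cases h0 : v 0 = 0
  · have h1 : v 1 ≠ 0 := by
      intro h1; apply hv; ext i; fin_cases i <;> simp [h0, h1]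
    refine ⟨x 1 1, ?_⟩
    have : x 0 1 = 0 := by
      have : x 0 1 * v 1 ^ 2 = 0 := by rw [h0] at h; linear_combination h
      simpa [h1] using this
    ext i; fin_cases i <;> simp [Matrix.mulVec, dotProduct, Fin.sum_univ_two, h0, this]
  · refine ⟨x 0 0 + x 0 1 * v 1 / v 0, ?_⟩
    ext i; fin_cases i
    · simp [Matrix.mulVec, dotProduct, Fin.sum_univ_two]; field_simp
    · simp [Matrix.mulVec, dotProduct, Fin.sum_univ_two]; field_simp
      linear_combination (-1) * h

/-- every trace-free matrix has an eigenvector -/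
lemma exeig15 (p q r : ℂ) : ∃ a b : ℂ, ¬ (a = 0 ∧ b = 0) ∧ 2 * p * a * b + q * b ^ 2 - r * a ^ 2 = 0 := by
  by_cases hq : r = 0
  · exact ⟨1, 0, by simp, by simp [hq]⟩
  · obtain ⟨z, hz⟩ := IsAlgClosed.exists_pow_nat_eq (p ^ 2 + q * r) (n := 2) (by norm_num)
    refine ⟨p + z, r, by simp [hq], ?_⟩
    linear_combination (-r) * hz

/-- a vector orthogonal to the isotropic nonzero vector `n` fixes its line -/
lemma iso15 (l m k : ℂ) (hn : l ^ 2 + m * k = 0) (h0 : ¬ (l = 0 ∧ k = 0) ∨ m ≠ 0) :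
    ∃ a b : ℂ, ¬ (a = 0 ∧ b = 0) ∧ ∀ p q r : ℂ, 2 * p * l + q * k + r * m = 0 →
      2 * p * a * b + q * b ^ 2 - r * a ^ 2 = 0 := by
  by_cases h : l = 0 ∧ k = 0
  · obtain ⟨rfl, rfl⟩ := h
    have hm : m ≠ 0 := by simpa using h0
    refine ⟨1, 0, by simp, fun p q r hh => ?_⟩
    have : r = 0 := by simpa [hm] using hh
    simp [this]
  · refine ⟨l, k, h, fun p q r hh => ?_⟩
    linear_combination k * hh - r * hn

/-- parallel vectors have the same eigenvectors -/
lemma par15 (p q r p' q' r' a b : ℂ) (h0 : ¬ (p = 0 ∧ q = 0 ∧ r = 0))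
    (hp : q * r' - r * q' = 0) (hq : p * q' - q * p' = 0) (hr : r * p' - p * r' = 0)
    (h : 2 * p * a * b + q * b ^ 2 - r * a ^ 2 = 0) :
    2 * p' * a * b + q' * b ^ 2 - r' * a ^ 2 = 0 := by
  by_cases h1 : p = 0
  · by_cases h2 : q = 0
    · have h3 : r ≠ 0 := by tauto
      refine (mul_eq_zero.1 (?_ : r * _ = 0)).resolve_left h3
      linear_combination r' * h + 2 * a * b * hr - b ^ 2 * hp
    · refine (mul_eq_zero.1 (?_ : q * _ = 0)).resolve_left h2
      linear_combination q' * h - 2 * a * b * hq - a ^ 2 * hp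
  · refine (mul_eq_zero.1 (?_ : p * _ = 0)).resolve_left h1
    linear_combination p' * h + b ^ 2 * hq + a ^ 2 * hr

lemma pair15 (p1 q1 r1 p2 q2 r2 p3 q3 r3 K : ℂ)
    (hk1 : sp15 p1 q1 r1 p1 q1 r1 = K) (hk2 : sp15 p2 q2 r2 p2 q2 r2 = K)
    (s : tp15 p1 q1 r1 p2 q2 r2 p3 q3 r3 = 0)
    (d12 : sp15 p1 q1 r1 p2 q2 r2 ^ 2 = K ^ 2)
    (hn : ¬ (q1 * r2 - r1 * q2 = 0 ∧ p1 * q2 - q1 * p2 = 0 ∧ r1 * p2 - p1 * r2 = 0)) :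
    ∃ a b : ℂ, ¬ (a = 0 ∧ b = 0) ∧ 2 * p1 * a * b + q1 * b ^ 2 - r1 * a ^ 2 = 0
      ∧ 2 * p2 * a * b + q2 * b ^ 2 - r2 * a ^ 2 = 0
      ∧ 2 * p3 * a * b + q3 * b ^ 2 - r3 * a ^ 2 = 0 := by
  have hd : ((q1 * r2 - r1 * q2) / 2) ^ 2 + (p1 * q2 - q1 * p2) * (r1 * p2 - p1 * r2) = 0 := by
    have : sp15 p1 q1 r1 p2 q2 r2 ^ 2 = sp15 p1 q1 r1 p1 q1 r1 * sp15 p2 q2 r2 p2 q2 r2 := by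
      rw [d12, hk1, hk2]; ring
    simp only [sp15] at this
    linear_combination this
  obtain ⟨a, b, hab, hh⟩ := iso15 _ _ _ hd (by
    by_contra hc; apply hn; push Not at hc; obtain ⟨⟨h1, h2⟩, h3⟩ := hc
    exact ⟨by linear_combination 2 * h1, h3, h2⟩)
  simp only [tp15] at s
  refine ⟨a, b, hab, hh _ _ _ ?_, hh _ _ _ ?_, hh _ _ _ ?_⟩
  · ring
  · ring
  · linear_combination 2 * s

lemma nondeg15 (p1 q1 r1 p2 q2 r2 p3 q3 r3 K : ℂ)
    (hk1 : sp15 p1 q1 r1 p1 q1 r1 = K) (hk2 : sp15 p2 q2 r2 p2 q2 r2 = K)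
    (hk3 : sp15 p3 q3 r3 p3 q3 r3 = K)
    (s : tp15 p1 q1 r1 p2 q2 r2 p3 q3 r3 = 0)
    (d12 : sp15 p1 q1 r1 p2 q2 r2 ^ 2 = K ^ 2) (d13 : sp15 p1 q1 r1 p3 q3 r3 ^ 2 = K ^ 2)
    (d23 : sp15 p2 q2 r2 p3 q3 r3 ^ 2 = K ^ 2) :
    ∃ a b : ℂ, ¬ (a = 0 ∧ b = 0) ∧ 2 * p1 * a * b + q1 * b ^ 2 - r1 * a ^ 2 = 0
      ∧ 2 * p2 * a * b + q2 * b ^ 2 - r2 * a ^ 2 = 0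
      ∧ 2 * p3 * a * b + q3 * b ^ 2 - r3 * a ^ 2 = 0 := by
  by_cases n12 : q1 * r2 - r1 * q2 = 0 ∧ p1 * q2 - q1 * p2 = 0 ∧ r1 * p2 - p1 * r2 = 0
  swap
  · exact pair15 p1 q1 r1 p2 q2 r2 p3 q3 r3 K hk1 hk2 s d12 n12
  by_cases n13 : q1 * r3 - r1 * q3 = 0 ∧ p1 * q3 - q1 * p3 = 0 ∧ r1 * p3 - p1 * r3 = 0
  swap
  · obtain ⟨a, b, h, h1, h2, h3⟩ := pair15 p1 q1 r1 p3 q3 r3 p2 q2 r2 K hk1 hk3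
      (by simp only [tp15] at s ⊢; linear_combination -s) d13 n13
    exact ⟨a, b, h, h1, h3, h2⟩
  by_cases n23 : q2 * r3 - r2 * q3 = 0 ∧ p2 * q3 - q2 * p3 = 0 ∧ r2 * p3 - p2 * r3 = 0
  swap
  · obtain ⟨a, b, h, h1, h2, h3⟩ := pair15 p2 q2 r2 p3 q3 r3 p1 q1 r1 K hk2 hk3
      (by simp only [tp15] at s ⊢; linear_combination s) d23 n23
    exact ⟨a, b, h, h3, h1, h2⟩
  by_cases z1 : p1 = 0 ∧ q1 = 0 ∧ r1 = 0
  · by_cases z2 : p2 = 0 ∧ q2 = 0 ∧ r2 = 0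
    · obtain ⟨a, b, h, h3⟩ := exeig15 p3 q3 r3
      exact ⟨a, b, h, by simp [z1], by simp [z2], h3⟩
    · obtain ⟨a, b, h, h2⟩ := exeig15 p2 q2 r2
      exact ⟨a, b, h, by simp [z1], h2, par15 _ _ _ _ _ _ a b z2 n23.1 n23.2.1 n23.2.2 h2⟩
  · obtain ⟨a, b, h, h1⟩ := exeig15 p1 q1 r1
    exact ⟨a, b, h, h1, par15 _ _ _ _ _ _ a b z1 n12.1 n12.2.1 n12.2.2 h1,
      par15 _ _ _ _ _ _ a b z1 n13.1 n13.2.1 n13.2.2 h1⟩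

/-- trace coordinates of a matrix in `SL2` -/
lemma coord15 (t : ℂ) (x : SL2) (h : ((x : 𝕄)).trace = t) :
    ∃ p q r : ℂ, (x : 𝕄) = !![t / 2 + p, q; r, t / 2 - p]
      ∧ ((x⁻¹ : SL2) : 𝕄) = !![t / 2 - p, -q; -r, t / 2 + p]
      ∧ (t / 2) ^ 2 - p ^ 2 - q * r = 1 := by
  have hd := x.det_coe
  rw [Matrix.det_fin_two] at hd
  rw [Matrix.trace_fin_two] at h
  refine ⟨((x : 𝕄) 0 0 - (x : 𝕄) 1 1) / 2, (x : 𝕄) 0 1, (x : 𝕄) 1 0, ?_, ?_, ?_⟩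
  · ext i j
    fin_cases i <;> fin_cases j <;> simp [← h] <;> ring
  · rw [Matrix.SpecialLinearGroup.coe_inv, Matrix.adjugate_fin_two]
    ext i j
    fin_cases i <;> fin_cases j <;> simp [← h] <;> ring
  · rw [← h]; linear_combination hd

lemma trmul15 (u p q r p' q' r' : ℂ) :
    (!![u + p, q; r, u - p] * !![u + p', q'; r', u - p'] : 𝕄).trace
      = 2 * u ^ 2 + 2 * sp15 p q r p' q' r' := by
  simp [Matrix.trace_fin_two, sp15]; ring

lemma chk15 (t p q r : ℂ) : chk !![t / 2 + p, q; r, t / 2 - p] = !![p, q; r, -p] := by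
  ext i j
  fin_cases i <;> fin_cases j <;> simp [chk, Matrix.trace_fin_two] <;> ring

lemma trtri15 (p q r p' q' r' p'' q'' r'' : ℂ) :
    (!![p, q; r, -p] * !![p', q'; r', -p'] * !![p'', q''; r'', -p''] : 𝕄).trace
      = 2 * tp15 p q r p' q' r' p'' q'' r'' := by
  simp [Matrix.trace_fin_two, tp15]; ring

/-- irreducibility in trace terms for coplanar triples -/
lemma irr15 (t : ℂ) (x₁ x₂ x₃ : SL2)
    (hx₁ : ((x₁ : 𝕄)).trace = t) (hx₂ : ((x₂ : 𝕄)).trace = t) (hx₃ : ((x₃ : 𝕄)).trace = t)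
    (hirr : IsIrreducibleFamily ![(x₁ : 𝕄), (x₂ : 𝕄), (x₃ : 𝕄)])
    (s : (chk (x₁ : 𝕄) * chk (x₂ : 𝕄) * chk (x₃ : 𝕄)).trace = 0) :
    ((((x₁ * x₂ : SL2) : 𝕄).trace - 2) * (((x₁ * x₂ : SL2) : 𝕄).trace - t ^ 2 + 2) ≠ 0) ∨
    ((((x₁ * x₃ : SL2) : 𝕄).trace - 2) * (((x₁ * x₃ : SL2) : 𝕄).trace - t ^ 2 + 2) ≠ 0) ∨
    ((((x₂ * x₃ : SL2) : 𝕄).trace - 2) * (((x₂ * x₃ : SL2) : 𝕄).trace - t ^ 2 + 2) ≠ 0) := by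
  obtain ⟨p1, q1, r1, h1, -, d1⟩ := coord15 t x₁ hx₁
  obtain ⟨p2, q2, r2, h2, -, d2⟩ := coord15 t x₂ hx₂
  obtain ⟨p3, q3, r3, h3, -, d3⟩ := coord15 t x₃ hx₃
  by_contra hc
  push Not at hc
  obtain ⟨c1, c2, c3⟩ := hc
  simp only [Matrix.SpecialLinearGroup.coe_mul] at c1 c2 c3
  rw [h1, h2, trmul15] at c1
  rw [h1, h3, trmul15] at c2
  rw [h2, h3, trmul15] at c3
  rw [h1, h2, h3, chk15, chk15, chk15, trtri15] at s
  apply hirr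
  obtain ⟨a, b, hab, e1, e2, e3⟩ := nondeg15 p1 q1 r1 p2 q2 r2 p3 q3 r3 ((t / 2) ^ 2 - 1)
    (by simp only [sp15]; linear_combination -d1) (by simp only [sp15]; linear_combination -d2)
    (by simp only [sp15]; linear_combination -d3) (by linear_combination s / 2)
    (by linear_combination c1 / 4) (by linear_combination c2 / 4) (by linear_combination c3 / 4)
  have hv : ![a, b] ≠ 0 := by
    intro h; apply hab
    exact ⟨by simpa using congrFun h 0, by simpa using congrFun h 1⟩
  refine ⟨![a, b], hv, fun i => ?_⟩
  fin_cases i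
  · refine eig15 _ _ hv ?_
    simp [h1]; linear_combination e1
  · refine eig15 _ _ hv ?_
    simp [h2]; linear_combination e2
  · refine eig15 _ _ hv ?_
    simp [h3]; linear_combination e3

lemma gram15 (p1 q1 r1 p2 q2 r2 p3 q3 r3 p4 q4 r4 : ℂ) :
    sp15 p1 q1 r1 p1 q1 r1 * (sp15 p2 q2 r2 p2 q2 r2 * sp15 p3 q3 r3 p4 q4 r4
        - sp15 p2 q2 r2 p4 q4 r4 * sp15 p2 q2 r2 p3 q3 r3)
      - sp15 p1 q1 r1 p2 q2 r2 * (sp15 p1 q1 r1 p2 q2 r2 * sp15 p3 q3 r3 p4 q4 r4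
        - sp15 p2 q2 r2 p4 q4 r4 * sp15 p1 q1 r1 p3 q3 r3)
      + sp15 p1 q1 r1 p4 q4 r4 * (sp15 p1 q1 r1 p2 q2 r2 * sp15 p2 q2 r2 p3 q3 r3
        - sp15 p2 q2 r2 p2 q2 r2 * sp15 p1 q1 r1 p3 q3 r3)
      = - tp15 p1 q1 r1 p2 q2 r2 p3 q3 r3 * tp15 p1 q1 r1 p2 q2 r2 p4 q4 r4 := by
  simp only [sp15, tp15]; ring

/-- if `a₁, a₂` span a degenerate line and the triple is nondegenerate then `a₂` is
a multiple of `a₁` -/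
lemma dep15 (p1 q1 r1 p2 q2 r2 p3 q3 r3 K g b c : ℂ)
    (k1 : sp15 p1 q1 r1 p1 q1 r1 = K) (k2 : sp15 p2 q2 r2 p2 q2 r2 = K)
    (k3 : sp15 p3 q3 r3 p3 q3 r3 = K) (hg : sp15 p1 q1 r1 p2 q2 r2 = g)
    (hb : sp15 p2 q2 r2 p3 q3 r3 = b) (hc : sp15 p1 q1 r1 p3 q3 r3 = c)
    (s : tp15 p1 q1 r1 p2 q2 r2 p3 q3 r3 = 0) (d : g ^ 2 = K ^ 2) (n : c ^ 2 ≠ K ^ 2) :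
    ∃ m : ℂ, p2 = m * p1 ∧ q2 = m * q1 ∧ r2 = m * r1 := by
  have hG := gram15 p1 q1 r1 p2 q2 r2 p3 q3 r3 p3 q3 r3
  rw [k1, k2, k3, hg, hb, hc, s] at hG
  have hz : K * b - c * g = 0 := by
    refine pow_eq_zero_iff (n := 2) (by norm_num) |>.1 ?_
    linear_combination (c ^ 2 - K ^ 2) * d - K * hG
  have hn : K ^ 2 - c ^ 2 ≠ 0 := fun h => n (by linear_combination -h)
  have e1 : (K ^ 2 - c ^ 2) * p2 = (K * g - c * b) * p1 := by
    have : (K ^ 2 - c ^ 2) * p2 = (K * g - c * b) * p1 + (K * b - c * g) * p3 := by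
      have : (sp15 p1 q1 r1 p1 q1 r1 * sp15 p3 q3 r3 p3 q3 r3 - sp15 p1 q1 r1 p3 q3 r3 ^ 2) * p2
          = (sp15 p3 q3 r3 p3 q3 r3 * sp15 p1 q1 r1 p2 q2 r2
              - sp15 p1 q1 r1 p3 q3 r3 * sp15 p2 q2 r2 p3 q3 r3) * p1
            + (sp15 p1 q1 r1 p1 q1 r1 * sp15 p2 q2 r2 p3 q3 r3
              - sp15 p1 q1 r1 p3 q3 r3 * sp15 p1 q1 r1 p2 q2 r2) * p3 := by
        simp only [tp15] at s
        simp only [sp15]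
        linear_combination ((q1 * r3 - r1 * q3)/2) * s
      rw [k1, k3, hg, hb, hc] at this
      linear_combination this
    rw [this, hz]; ring
  have e2 : (K ^ 2 - c ^ 2) * q2 = (K * g - c * b) * q1 := by
    have : (K ^ 2 - c ^ 2) * q2 = (K * g - c * b) * q1 + (K * b - c * g) * q3 := by
      have : (sp15 p1 q1 r1 p1 q1 r1 * sp15 p3 q3 r3 p3 q3 r3 - sp15 p1 q1 r1 p3 q3 r3 ^ 2) * q2
          = (sp15 p3 q3 r3 p3 q3 r3 * sp15 p1 q1 r1 p2 q2 r2
              - sp15 p1 q1 r1 p3 q3 r3 * sp15 p2 q2 r2 p3 q3 r3) * q1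
            + (sp15 p1 q1 r1 p1 q1 r1 * sp15 p2 q2 r2 p3 q3 r3
              - sp15 p1 q1 r1 p3 q3 r3 * sp15 p1 q1 r1 p2 q2 r2) * q3 := by
        simp only [tp15] at s
        simp only [sp15]
        linear_combination (p1 * q3 - q1 * p3) * s
      rw [k1, k3, hg, hb, hc] at this
      linear_combination this
    rw [this, hz]; ring
  have e3 : (K ^ 2 - c ^ 2) * r2 = (K * g - c * b) * r1 := by
    have : (K ^ 2 - c ^ 2) * r2 = (K * g - c * b) * r1 + (K * b - c * g) * r3 := by
      have : (sp15 p1 q1 r1 p1 q1 r1 * sp15 p3 q3 r3 p3 q3 r3 - sp15 p1 q1 r1 p3 q3 r3 ^ 2) * r2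
          = (sp15 p3 q3 r3 p3 q3 r3 * sp15 p1 q1 r1 p2 q2 r2
              - sp15 p1 q1 r1 p3 q3 r3 * sp15 p2 q2 r2 p3 q3 r3) * r1
            + (sp15 p1 q1 r1 p1 q1 r1 * sp15 p2 q2 r2 p3 q3 r3
              - sp15 p1 q1 r1 p3 q3 r3 * sp15 p1 q1 r1 p2 q2 r2) * r3 := by
        simp only [tp15] at s
        simp only [sp15]
        linear_combination (r1 * p3 - p1 * r3) * s
      rw [k1, k3, hg, hb, hc] at this
      linear_combination this
    rw [this, hz]; ring
  refine ⟨(K * g - c * b) / (K ^ 2 - c ^ 2), ?_, ?_, ?_⟩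
  · field_simp; linear_combination e1
  · field_simp; linear_combination e2
  · field_simp; linear_combination e3

lemma spsymm15 (p q r p' q' r' : ℂ) : sp15 p q r p' q' r' = sp15 p' q' r' p q r := by
  simp only [sp15]; ring

lemma core15 (t : ℂ) (x₁ x₂ x₃ x₄ : SL2)
    (hx₁ : ((x₁ : 𝕄)).trace = t) (hx₂ : ((x₂ : 𝕄)).trace = t)
    (hx₃ : ((x₃ : 𝕄)).trace = t) (hx₄ : ((x₄ : 𝕄)).trace = t)
    (hr₁₂ : x₁ * x₂ * x₁⁻¹ * x₄ * x₁ = x₂ * x₃ * x₂⁻¹ * x₁ * x₂)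
    (hr₂₃ : x₂ * x₃ * x₂⁻¹ * x₁ * x₂ = x₃ * x₄ * x₃⁻¹ * x₂ * x₃)
    (hr₃₄ : x₃ * x₄ * x₃⁻¹ * x₂ * x₃ = x₄ * x₁ * x₄⁻¹ * x₃ * x₄)
    (hnd : ((((x₁ * x₂ : SL2) : 𝕄).trace - 2) * (((x₁ * x₂ : SL2) : 𝕄).trace - t ^ 2 + 2) ≠ 0) ∨
      ((((x₁ * x₃ : SL2) : 𝕄).trace - 2) * (((x₁ * x₃ : SL2) : 𝕄).trace - t ^ 2 + 2) ≠ 0) ∨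
      ((((x₂ * x₃ : SL2) : 𝕄).trace - 2) * (((x₂ * x₃ : SL2) : 𝕄).trace - t ^ 2 + 2) ≠ 0))
    (h1324 : ((x₁ * x₃ : SL2) : 𝕄).trace = ((x₂ * x₄ : SL2) : 𝕄).trace)
    (h1423 : ((x₁ * x₄ : SL2) : 𝕄).trace = ((x₂ * x₃ : SL2) : 𝕄).trace)
    (h1234 : ((x₁ * x₂ : SL2) : 𝕄).trace ≠ ((x₃ * x₄ : SL2) : 𝕄).trace)
    (hs : (chk (x₁ : 𝕄) * chk (x₂ : 𝕄) * chk (x₃ : 𝕄)).trace = 0) : t = 0 := by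
  obtain ⟨p1, q1, r1, h1, i1, d1⟩ := coord15 t x₁ hx₁
  obtain ⟨p2, q2, r2, h2, i2, d2⟩ := coord15 t x₂ hx₂
  obtain ⟨p3, q3, r3, h3, i3, d3⟩ := coord15 t x₃ hx₃
  obtain ⟨p4, q4, r4, h4, i4, d4⟩ := coord15 t x₄ hx₄
  have hR := congrArg (fun x : SL2 => (x : 𝕄)) hr₂₃
  simp only [Matrix.SpecialLinearGroup.coe_mul] at hR h1324 h1423 h1234 hnd
  rw [h1, h2, h3, h4, i2, i3] at hR
  rw [h1, h2, h3, chk15, chk15, chk15, trtri15] at hs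
  rw [h1, h2, h3, h4, trmul15, trmul15] at h1234 h1324 h1423
  rw [h1, h2, h3, trmul15, trmul15, trmul15] at hnd
  have s3 : tp15 p1 q1 r1 p2 q2 r2 p3 q3 r3 = 0 := by linear_combination hs / 2
  obtain ⟨K, hK⟩ : ∃ K : ℂ, K = (t / 2) ^ 2 - 1 := ⟨_, rfl⟩
  have k1 : sp15 p1 q1 r1 p1 q1 r1 = K := by rw [hK]; simp only [sp15]; linear_combination -d1
  have k2 : sp15 p2 q2 r2 p2 q2 r2 = K := by rw [hK]; simp only [sp15]; linear_combination -d2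
  have k3 : sp15 p3 q3 r3 p3 q3 r3 = K := by rw [hK]; simp only [sp15]; linear_combination -d3
  have k4 : sp15 p4 q4 r4 p4 q4 r4 = K := by rw [hK]; simp only [sp15]; linear_combination -d4
  obtain ⟨g, hg⟩ : ∃ g, sp15 p1 q1 r1 p2 q2 r2 = g := ⟨_, rfl⟩
  obtain ⟨b, hb⟩ : ∃ b, sp15 p2 q2 r2 p3 q3 r3 = b := ⟨_, rfl⟩
  obtain ⟨c, hc⟩ : ∃ c, sp15 p1 q1 r1 p3 q3 r3 = c := ⟨_, rfl⟩
  obtain ⟨f, hf⟩ : ∃ f, sp15 p3 q3 r3 p4 q4 r4 = f := ⟨_, rfl⟩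
  have hb' : sp15 p1 q1 r1 p4 q4 r4 = b := by rw [← hb]; linear_combination h1423 / 2
  have hc' : sp15 p2 q2 r2 p4 q4 r4 = c := by rw [← hc]; linear_combination -h1324 / 2
  rw [hg, hf] at h1234
  rw [hg, hb, hc] at hnd
  have hgf : g ≠ f := fun h => h1234 (by rw [h])
  by_contra ht
  have G3 := gram15 p1 q1 r1 p2 q2 r2 p3 q3 r3 p3 q3 r3
  have G4 := gram15 p1 q1 r1 p2 q2 r2 p4 q4 r4 p4 q4 r4
  have G34 := gram15 p1 q1 r1 p2 q2 r2 p3 q3 r3 p4 q4 r4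
  rw [k1, k2, k3, hg, hb, hc, s3] at G3
  rw [k1, k2, k4, hg, hb', hc'] at G4
  rw [k1, k2, hf, hg, hb, hb', hc, hc', s3] at G34
  have s4 : tp15 p1 q1 r1 p2 q2 r2 p4 q4 r4 = 0 := by
    refine pow_eq_zero_iff (n := 2) (by norm_num) |>.1 ?_
    linear_combination G4 - G3
  by_cases hD : K ^ 2 - g ^ 2 = 0
  swap
  · -- generic case
    have E := keyE15 (t / 2) p1 q1 r1 p2 q2 r2 p3 q3 r3 p4 q4 r4 d2 d3 hR s3 s4
    rw [k1, k2, hg, hb, hb', hc, hc'] at E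
    have E' : (b - c - (K - g)) * (b + c - (K + g)) = 0 := by
      have := (mul_eq_zero.1 E).resolve_left (by simpa using ht)
      linear_combination -this
    apply hgf
    have : (K ^ 2 - g ^ 2) * (g - f) = 0 := by
      rcases mul_eq_zero.1 E' with e | e
      · linear_combination G3 - G34 + (K + g) * (b - c + (K - g)) * e
      · linear_combination -G3 - G34 - (K - g) * (b + c + (K + g)) * e
    have := (mul_eq_zero.1 this).resolve_left hD
    linear_combination this
  · -- degenerate case
    have hfK : x₄ = x₃ → f = K := by
      intro h34
      have h6 : !![t / 2 + p4, q4; r4, t / 2 - p4] = !![t / 2 + p3, q3; r3, t / 2 - p3] := by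
        rw [← h4, ← h3, h34]
      have z1 : p4 = p3 := by
        have := congrFun (congrFun h6 0) 0
        simpa using this
      have z2 : q4 = q3 := by
        have := congrFun (congrFun h6 0) 1
        simpa using this
      have z3 : r4 = r3 := by
        have := congrFun (congrFun h6 1) 0
        simpa using this
      rw [← hf, z1, z2, z3, k3]
    have hgK : g ^ 2 = K ^ 2 := by linear_combination -hD
    have hpar : ∃ m : ℂ, m ^ 2 = 1 ∧ p2 = m * p1 ∧ q2 = m * q1 ∧ r2 = m * r1 := by
      have hcases : c ^ 2 ≠ K ^ 2 ∨ b ^ 2 ≠ K ^ 2 := by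
        rcases hnd with h | h | h
        · exact absurd (by rw [hK] at hgK; linear_combination 4 * hgK) h
        · left; intro e; apply h; rw [hK] at e; linear_combination 4 * e
        · right; intro e; apply h; rw [hK] at e; linear_combination 4 * e
      rcases hcases with n | n
      · obtain ⟨m, e1, e2, e3⟩ := dep15 p1 q1 r1 p2 q2 r2 p3 q3 r3 K g b c k1 k2 k3 hg hb hc s3 hgK n
        refine ⟨m, ?_, e1, e2, e3⟩
        have a1 : K = m ^ 2 * K := by
          rw [← k1]; rw [← k2, e1, e2, e3] at k1; simp only [sp15] at k1 ⊢; linear_combination k1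
        have a2 : b = m * c := by
          rw [← hb, ← hc, e1, e2, e3]; simp only [sp15]; ring
        have a3 : c = m * b := by
          rw [← hb', ← hc', e1, e2, e3]; simp only [sp15]; ring
        by_contra hm
        have hm' : m ^ 2 - 1 ≠ 0 := sub_ne_zero.2 hm
        have b1 : K = 0 := (mul_eq_zero.1 (by linear_combination -a1 : (m ^ 2 - 1) * K = 0)).resolve_left hm'
        have b2 : c = 0 := (mul_eq_zero.1 (by linear_combination -a3 - m * a2 : (m ^ 2 - 1) * c = 0)).resolve_left hm'
        apply n; rw [b1, b2]
      · obtain ⟨m, e1, e2, e3⟩ := dep15 p2 q2 r2 p1 q1 r1 p3 q3 r3 K g c b k2 k1 k3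
          (by rw [spsymm15]; exact hg) hc hb
          (by simp only [tp15] at s3 ⊢; linear_combination -s3) hgK n
        have a1 : K = m ^ 2 * K := by
          rw [← k2]; rw [← k1, e1, e2, e3] at k2; simp only [sp15] at k2 ⊢; linear_combination k2
        have a2 : c = m * b := by
          rw [← hb, ← hc, e1, e2, e3]; simp only [sp15]; ring
        have a3 : b = m * c := by
          rw [← hb', ← hc', e1, e2, e3]; simp only [sp15]; ring
        have hm2 : m ^ 2 = 1 := by
          by_contra hm
          have hm' : m ^ 2 - 1 ≠ 0 := sub_ne_zero.2 hm
          have b1 : K = 0 := (mul_eq_zero.1 (by linear_combination -a1 : (m ^ 2 - 1) * K = 0)).resolve_left hm'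
          have b2 : b = 0 := (mul_eq_zero.1 (by linear_combination -a3 - m * a2 : (m ^ 2 - 1) * b = 0)).resolve_left hm'
          apply n; rw [b1, b2]
        refine ⟨m, hm2, ?_, ?_, ?_⟩
        · rw [e1]; linear_combination -p2 * hm2
        · rw [e2]; linear_combination -q2 * hm2
        · rw [e3]; linear_combination -r2 * hm2
    obtain ⟨m, hm, e1, e2, e3⟩ := hpar
    have hm' : m = 1 ∨ m = -1 := by
      rcases mul_eq_zero.1 (by linear_combination hm : (m - 1) * (m + 1) = 0) with h | h
      · left; linear_combination h
      · right; linear_combination h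
    rcases hm' with rfl | rfl
    · -- equal generators
      have h12 : x₂ = x₁ := by
        apply Subtype.ext
        change (x₂ : 𝕄) = (x₁ : 𝕄)
        rw [h1, h2, e1, e2, e3]; simp
      have h34 : x₄ = x₃ := by
        rw [h12] at hr₁₂
        have : x₁ * x₄ * x₁ = x₁ * x₃ * x₁ := by
          calc x₁ * x₄ * x₁ = x₁ * x₁ * x₁⁻¹ * x₄ * x₁ := by group
            _ = _ := hr₁₂
            _ = _ := by group
        exact mul_left_cancel (mul_right_cancel this)
      apply hgf
      rw [← hg, hfK h34, e1, e2, e3, ← k1]; simp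
    · -- mutually inverse generators
      have h12 : x₂ = x₁⁻¹ := by
        apply Subtype.ext
        change (x₂ : 𝕄) = ((x₁⁻¹ : SL2) : 𝕄)
        rw [i1, h2, e1, e2, e3]; simp [sub_eq_add_neg]
      have h34 : x₄ = x₃ := by
        rw [h12] at hr₁₂
        have : x₁⁻¹ * x₄ * x₁ = x₁⁻¹ * x₃ * x₁ := by
          calc x₁⁻¹ * x₄ * x₁ = x₁ * x₁⁻¹ * x₁⁻¹ * x₄ * x₁ := by group
            _ = _ := hr₁₂
            _ = _ := by group
        exact mul_left_cancel (mul_right_cancel this)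
      rw [h12, h34] at hr₃₄
      have h5 : x₁⁻¹ = x₁ := by
        have : x₃ * x₁⁻¹ * x₃ = x₃ * x₁ * x₃ := by
          calc x₃ * x₁⁻¹ * x₃ = x₃ * x₃ * x₃⁻¹ * x₁⁻¹ * x₃ := by group
            _ = _ := hr₃₄
            _ = _ := by group
        exact mul_left_cancel (mul_right_cancel this)
      have h6 : !![t / 2 - p1, -q1; -r1, t / 2 + p1] = !![t / 2 + p1, q1; r1, t / 2 - p1] := by
        rw [← i1, ← h1, h5]
      have z1 : p1 = 0 := by
        have := congrFun (congrFun h6 0) 0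
        simp at this; linear_combination -this / 2
      have z2 : q1 = 0 := by
        have := congrFun (congrFun h6 0) 1
        simp at this; linear_combination -this / 2
      have z3 : r1 = 0 := by
        have := congrFun (congrFun h6 1) 0
        simp at this; linear_combination -this / 2
      apply hgf
      rw [← hg, hfK h34, ← k1, z1, z2, z3]; simp [sp15]

lemma trzero15 (p q r p' q' r' p'' q'' r'' : ℂ) (h : (0 : ℂ) ^ 2 - p ^ 2 - q * r = 1) :
    (!![0 + p, q; r, 0 - p] * !![0 + p', q'; r', 0 - p'] * !![0 - p, -q; -r, 0 + p]
        * !![0 + p'', q''; r'', 0 - p''] * !![0 + p, q; r, 0 - p] : 𝕄).trace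
      = - 2 * tp15 p q r p' q' r' p'' q'' r'' := by
  simp [Matrix.trace_fin_two, tp15]
  linear_combination (-(p * (q' * r'' - r' * q'') + q * (r' * p'' - p' * r'')
    + r * (p' * q'' - q' * p''))) * h

lemma zero15 (p1 q1 r1 p2 q2 r2 p3 q3 r3 p4 q4 r4 s : ℂ)
    (h1 : tp15 p1 q1 r1 p2 q2 r2 p4 q4 r4 = s) (h2 : tp15 p2 q2 r2 p3 q3 r3 p1 q1 r1 = s)
    (h3 : tp15 p3 q3 r3 p4 q4 r4 p2 q2 r2 = s) (h4 : tp15 p4 q4 r4 p1 q1 r1 p3 q3 r3 = s)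
    (hs : s ≠ 0) : p4 = p1 - p2 + p3 ∧ q4 = q1 - q2 + q3 ∧ r4 = r1 - r2 + r3 := by
  simp only [tp15] at *
  refine ⟨?_, ?_, ?_⟩ <;> refine mul_left_cancel₀ hs ?_
  · linear_combination p1 * h3 - p2 * h4 + p3 * h1 - p4 * h2
  · linear_combination q1 * h3 - q2 * h4 + q3 * h1 - q4 * h2
  · linear_combination r1 * h3 - r2 * h4 + r3 * h1 - r4 * h2

lemma trinv15 (x : SL2) : ((x⁻¹ : SL2) : 𝕄).trace = ((x : 𝕄)).trace := by
  rw [Matrix.SpecialLinearGroup.coe_inv, Matrix.adjugate_fin_two]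
  simp [Matrix.trace_fin_two]; ring

lemma trinvmul15 (x y : SL2) : ((x⁻¹ * y⁻¹ : SL2) : 𝕄).trace = ((y * x : SL2) : 𝕄).trace := by
  rw [← _root_.mul_inv_rev, trinv15]

lemma trcomm15 (x y : SL2) : ((x * y : SL2) : 𝕄).trace = ((y * x : SL2) : 𝕄).trace := by
  rw [Matrix.SpecialLinearGroup.coe_mul, Matrix.SpecialLinearGroup.coe_mul, Matrix.trace_mul_comm]

lemma chkinv15 (t p q r : ℂ) :
    chk !![t / 2 - p, -q; -r, t / 2 + p] = !![-p, -q; -r, -(-p)] := by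
  have := chk15 t (-p) (-q) (-r)
  simpa [sub_eq_add_neg] using this

lemma tzero15 (x₁ x₂ x₃ x₄ : SL2)
    (hx₁ : ((x₁ : 𝕄)).trace = 0) (hx₂ : ((x₂ : 𝕄)).trace = 0)
    (hx₃ : ((x₃ : 𝕄)).trace = 0) (hx₄ : ((x₄ : 𝕄)).trace = 0)
    (hr₁₂ : x₁ * x₂ * x₁⁻¹ * x₄ * x₁ = x₂ * x₃ * x₂⁻¹ * x₁ * x₂)
    (hr₂₃ : x₂ * x₃ * x₂⁻¹ * x₁ * x₂ = x₃ * x₄ * x₃⁻¹ * x₂ * x₃)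
    (hr₃₄ : x₃ * x₄ * x₃⁻¹ * x₂ * x₃ = x₄ * x₁ * x₄⁻¹ * x₃ * x₄)
    (h1234 : ((x₁ * x₂ : SL2) : 𝕄).trace ≠ ((x₃ * x₄ : SL2) : 𝕄).trace) :
    (chk (x₁ : 𝕄) * chk (x₂ : 𝕄) * chk (x₃ : 𝕄)).trace = 0 ∧
    (chk (x₂ : 𝕄) * chk (x₃ : 𝕄) * chk (x₄ : 𝕄)).trace = 0 := by
  obtain ⟨p1, q1, r1, h1, i1, d1⟩ := coord15 0 x₁ hx₁
  obtain ⟨p2, q2, r2, h2, i2, d2⟩ := coord15 0 x₂ hx₂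
  obtain ⟨p3, q3, r3, h3, i3, d3⟩ := coord15 0 x₃ hx₃
  obtain ⟨p4, q4, r4, h4, i4, d4⟩ := coord15 0 x₄ hx₄
  have R1 := congrArg (fun x : SL2 => (x : 𝕄).trace) hr₁₂
  have R2 := congrArg (fun x : SL2 => (x : 𝕄).trace) hr₂₃
  have R3 := congrArg (fun x : SL2 => (x : 𝕄).trace) hr₃₄
  simp only [Matrix.SpecialLinearGroup.coe_mul] at R1 R2 R3 h1234
  rw [h1, h2, h3, chk15, chk15, chk15, h4, chk15, trtri15, trtri15]
  rw [h1, h2, h3, h4, trmul15, trmul15] at h1234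
  rw [h1, h2, h3, h4, i1, i2] at R1
  rw [h1, h2, h3, h4, i2, i3] at R2
  rw [h1, h2, h3, h4, i3, i4] at R3
  rw [zero_div] at R1 R2 R3 d1 d2 d3 d4
  rw [trzero15 _ _ _ _ _ _ _ _ _ d1, trzero15 _ _ _ _ _ _ _ _ _ d2] at R1
  rw [trzero15 _ _ _ _ _ _ _ _ _ d2, trzero15 _ _ _ _ _ _ _ _ _ d3] at R2
  rw [trzero15 _ _ _ _ _ _ _ _ _ d3, trzero15 _ _ _ _ _ _ _ _ _ d4] at R3
  have key : tp15 p2 q2 r2 p3 q3 r3 p1 q1 r1 = 0 := by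
    by_contra hs
    obtain ⟨e1, e2, e3⟩ := zero15 p1 q1 r1 p2 q2 r2 p3 q3 r3 p4 q4 r4 _
      (by linear_combination -R1 / 2) rfl (by linear_combination R2 / 2)
      (by linear_combination R2 / 2 + R3 / 2) hs
    apply h1234
    simp only [sp15]
    rw [e1, e2, e3] at d4 ⊢
    linear_combination -d1 - d2 + d3 + d4
  constructor
  · simp only [tp15] at key ⊢; linear_combination 2 * key
  · simp only [tp15] at key R2 ⊢; linear_combination 2 * key + R2

/-- Under the trace equations of 8₁₈ with all triples irreducible,
`tr(xᵢxᵢ₊₁) ≠ 1`, `tr(x₁x₃) = tr(x₂x₄)`, `tr(x₁x₄) = tr(x₂x₃)` and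
`tr(x₁x₂) ≠ tr(x₃x₄)`, either `t = s₁₂₃ = s₂₃₄ = 0` or `t·s₁₂₃·s₂₃₄ ≠ 0`. -/
theorem stmt15 (t : ℂ) (x₁ x₂ x₃ x₄ : SL2)
    (hx₁ : ((x₁ : 𝕄)).trace = t) (hx₂ : ((x₂ : 𝕄)).trace = t)
    (hx₃ : ((x₃ : 𝕄)).trace = t) (hx₄ : ((x₄ : 𝕄)).trace = t)
    (hr₁₂ : x₁ * x₂ * x₁⁻¹ * x₄ * x₁ = x₂ * x₃ * x₂⁻¹ * x₁ * x₂)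
    (hr₂₃ : x₂ * x₃ * x₂⁻¹ * x₁ * x₂ = x₃ * x₄ * x₃⁻¹ * x₂ * x₃)
    (hr₃₄ : x₃ * x₄ * x₃⁻¹ * x₂ * x₃ = x₄ * x₁ * x₄⁻¹ * x₃ * x₄)
    (hirr₁₂₃ : IsIrreducibleFamily ![(x₁ : 𝕄), (x₂ : 𝕄), (x₃ : 𝕄)])
    (hirr₁₂₄ : IsIrreducibleFamily ![(x₁ : 𝕄), (x₂ : 𝕄), (x₄ : 𝕄)])
    (hirr₁₃₄ : IsIrreducibleFamily ![(x₁ : 𝕄), (x₃ : 𝕄), (x₄ : 𝕄)])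
    (hirr₂₃₄ : IsIrreducibleFamily ![(x₂ : 𝕄), (x₃ : 𝕄), (x₄ : 𝕄)])
    (ht₁₂ : ((x₁ * x₂ : SL2) : 𝕄).trace ≠ 1) (ht₂₃ : ((x₂ * x₃ : SL2) : 𝕄).trace ≠ 1)
    (ht₃₄ : ((x₃ * x₄ : SL2) : 𝕄).trace ≠ 1) (ht₄₁ : ((x₄ * x₁ : SL2) : 𝕄).trace ≠ 1)
    (h1324 : ((x₁ * x₃ : SL2) : 𝕄).trace = ((x₂ * x₄ : SL2) : 𝕄).trace)
    (h1423 : ((x₁ * x₄ : SL2) : 𝕄).trace = ((x₂ * x₃ : SL2) : 𝕄).trace)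
    (h1234 : ((x₁ * x₂ : SL2) : 𝕄).trace ≠ ((x₃ * x₄ : SL2) : 𝕄).trace)
    (s₁₂₃ s₂₃₄ : ℂ)
    (hs₁₂₃ : s₁₂₃ = (chk (x₁ : 𝕄) * chk (x₂ : 𝕄) * chk (x₃ : 𝕄)).trace)
    (hs₂₃₄ : s₂₃₄ = (chk (x₂ : 𝕄) * chk (x₃ : 𝕄) * chk (x₄ : 𝕄)).trace) :
    (t = 0 ∧ s₁₂₃ = 0 ∧ s₂₃₄ = 0) ∨ t * s₁₂₃ * s₂₃₄ ≠ 0 := by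
  
  have c1 : s₁₂₃ = 0 → t = 0 := by
    intro h
    rw [hs₁₂₃] at h
    exact core15 t x₁ x₂ x₃ x₄ hx₁ hx₂ hx₃ hx₄ hr₁₂ hr₂₃ hr₃₄
      (irr15 t x₁ x₂ x₃ hx₁ hx₂ hx₃ hirr₁₂₃ h) h1324 h1423 h1234 h
  have c2 : s₂₃₄ = 0 → t = 0 := by
    intro h
    rw [hs₂₃₄] at h
    have hn := irr15 t x₂ x₃ x₄ hx₂ hx₃ hx₄ hirr₂₃₄ h
    refine core15 t x₄⁻¹ x₃⁻¹ x₂⁻¹ x₁⁻¹ (by rw [trinv15, hx₄]) (by rw [trinv15, hx₃])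
      (by rw [trinv15, hx₂]) (by rw [trinv15, hx₁]) ?_ ?_ ?_ ?_ ?_ ?_ ?_ ?_
    · have := congrArg (fun x => x⁻¹) hr₃₄.symm
      simpa [mul_assoc] using this
    · have := congrArg (fun x => x⁻¹) hr₂₃.symm
      simpa [mul_assoc] using this
    · have := congrArg (fun x => x⁻¹) hr₁₂.symm
      simpa [mul_assoc] using this
    · rw [trinvmul15, trinvmul15, trinvmul15]
      tauto
    · rw [trinvmul15, trinvmul15, h1324]
    · rw [trinvmul15, trinvmul15, h1423]
    · rw [trinvmul15, trinvmul15]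
      exact h1234.symm
    · obtain ⟨p2, q2, r2, h2, i2, d2⟩ := coord15 t x₂ hx₂
      obtain ⟨p3, q3, r3, h3, i3, d3⟩ := coord15 t x₃ hx₃
      obtain ⟨p4, q4, r4, h4, i4, d4⟩ := coord15 t x₄ hx₄
      rw [i2, i3, i4, chkinv15, chkinv15, chkinv15, trtri15]
      rw [h2, h3, h4, chk15, chk15, chk15, trtri15] at h
      simp only [tp15] at h ⊢
      linear_combination h
  by_cases ht : t = 0
  · left
    subst ht
    obtain ⟨a, b⟩ := tzero15 x₁ x₂ x₃ x₄ hx₁ hx₂ hx₃ hx₄ hr₁₂ hr₂₃ hr₃₄ h1234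
    exact ⟨rfl, hs₁₂₃.trans a, hs₂₃₄.trans b⟩
  · right
    exact mul_ne_zero (mul_ne_zero ht (fun h => ht (c1 h))) (fun h => ht (c2 h))
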